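/- For l ≥ 0 and φ, χ in the weighted Sobolev space H^{2,l}(ℝ³), the product satisfies ‖φχ‖_{H^{2,l}} ≲ ‖φ‖_{H^{2,l}} ‖χ‖_{H^{2,l}}. -/

import Mathlib

open MeasureTheory ENNReal

/-- Physical space `ℝ³`. -/
abbrev E3 : Type := EuclideanSpace ℝ (Fin 3)

/-- The `H²` norm: `‖f‖₂ + ‖Df‖₂ + ‖D²f‖₂` (as an extended nonnegative real). -/
noncomputable def H2norm (f : E3 → ℂ) : ℝ≥0∞ :=
  eLpNorm f 2 volume + eLpNorm (fun x => ‖iteratedFDeriv ℝ 1 f x‖) 2 volume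
    + eLpNorm (fun x => ‖iteratedFDeriv ℝ 2 f x‖) 2 volume

/-- The Laplacian `Δf = ∑ᵢ ∂²f/∂xᵢ²`. -/
noncomputable def lap (f : E3 → ℂ) (x : E3) : ℂ :=
  ∑ i : Fin 3,
    iteratedFDeriv ℝ 2 f x ![EuclideanSpace.single i 1, EuclideanSpace.single i 1]

/-- The `W^{2,1}` norm: `‖f‖_{L¹} + ‖Δf‖_{L¹}`. -/
noncomputable def W21norm (f : E3 → ℂ) : ℝ≥0∞ :=
  eLpNorm f 1 volume + eLpNorm (lap f) 1 volume

/-- The weighted `H^{2,l}` norm: `‖⟨x⟩^l f‖_{H²}` with `⟨x⟩ = √(1+|x|²)`. -/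
noncomputable def H2wnorm (l : ℝ) (f : E3 → ℂ) : ℝ≥0∞ :=
  H2norm (fun x => (((1 + ‖x‖ ^ 2) ^ (l / 2) : ℝ) : ℂ) * f x)

abbrev A3 : Type := E3 →L[ℝ] ℂ

lemma aux_cutoff : ∃ K : ℝ, 0 ≤ K ∧ ∀ n : ℕ, ∃ η : E3 → ℝ, ContDiff ℝ 1 η ∧ HasCompactSupport η ∧
    (∀ x, ‖η x‖ ≤ 1) ∧ (∀ x, ‖fderiv ℝ η x‖ ≤ K) ∧ ∀ x, ‖x‖ ≤ n → η x = 1 := by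
  let b : ContDiffBump (0 : E3) := ⟨1, 2, by norm_num, by norm_num⟩
  have hb : ContDiff ℝ 1 b := b.contDiff
  have hbs : HasCompactSupport b := b.hasCompactSupport
  obtain ⟨K, hK⟩ := (hbs.fderiv (𝕜 := ℝ)).exists_bound_of_continuous (hb.continuous_fderiv one_ne_zero)
  have hK0 : 0 ≤ K := (norm_nonneg _).trans (hK 0)
  refine ⟨K, hK0, fun n => ⟨fun x => b (((n:ℝ)+1)⁻¹ • x), ?_, ?_, ?_, ?_, ?_⟩⟩
  · exact hb.comp (contDiff_const_smul _)
  · exact hbs.comp_smul (by positivity)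
  · intro x
    rw [Real.norm_eq_abs, abs_of_nonneg b.nonneg]
    exact b.le_one
  · intro x
    rw [fderiv_comp_smul, norm_smul]
    have h1 : ‖((n:ℝ)+1)⁻¹‖ ≤ 1 := by
      rw [Real.norm_eq_abs, abs_of_nonneg (by positivity)]
      exact inv_le_one_of_one_le₀ (by linarith [(Nat.cast_nonneg n : (0:ℝ) ≤ n)])
    calc _ ≤ 1 * K := by gcongr; exact hK _
      _ = K := one_mul _
  · intro x hx
    apply b.one_of_mem_closedBall
    simp only [Metric.mem_closedBall, dist_zero_right, norm_smul]
    rw [Real.norm_eq_abs, abs_of_nonneg (by positivity)]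
    rw [inv_mul_le_iff₀ (by positivity)]
    change _ ≤ ((n:ℝ)+1) * 1
    linarith

lemma aux_L6 (F : Type) [NormedAddCommGroup F] [NormedSpace ℝ F] [FiniteDimensional ℝ F] :
    ∃ C : ℝ≥0∞, C ≠ ⊤ ∧ ∀ g : E3 → F, ContDiff ℝ 1 g →
    eLpNorm g 6 volume ≤ C * (eLpNorm g 2 volume + eLpNorm (fderiv ℝ g) 2 volume) := by
  obtain ⟨K, hK0, hη⟩ := aux_cutoff
  choose η h1 h2 h3 h4 h5 using hη
  refine ⟨(SNormLESNormFDerivOfEqConst F (volume : Measure E3) 2 : ℝ≥0∞) *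
    (ENNReal.ofReal K + 1), by finiteness, fun g hg => ?_⟩
  have key : ∀ n, eLpNorm (fun x => η n x • g x) 6 volume ≤
      (SNormLESNormFDerivOfEqConst F (volume : Measure E3) 2 : ℝ≥0∞) *
    (ENNReal.ofReal K + 1) * (eLpNorm g 2 volume + eLpNorm (fderiv ℝ g) 2 volume) := by
    intro n
    have hs := eLpNorm_le_eLpNorm_fderiv_of_eq (volume : Measure E3) (u := fun x => η n x • g x)
      ((h1 n).smul hg) ((h2 n).smul_right) (p := 2) (p' := 6) (by norm_num) (by simp)
      (by simp; norm_num)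
    refine (by simpa using hs : _ ≤ _).trans ?_
    rw [mul_assoc]
    gcongr
    have hfd : ∀ x, ‖fderiv ℝ (fun x => η n x • g x) x‖ ≤ ‖(K * ‖g x‖ + ‖fderiv ℝ g x‖ : ℝ)‖ := by
      intro x
      rw [fderiv_fun_smul ((h1 n).differentiable one_ne_zero x) (hg.differentiable one_ne_zero x)]
      refine (norm_add_le _ _).trans ?_
      rw [norm_smul, Real.norm_of_nonneg (by positivity : 0 ≤ K * ‖g x‖ + ‖fderiv ℝ g x‖), add_comm]
      gcongr
      · refine (ContinuousLinearMap.norm_smulRight_apply _ _).le.trans ?_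
        gcongr
        exact h4 n x
      · calc _ ≤ 1 * ‖fderiv ℝ g x‖ := by gcongr; exact h3 n x
          _ = _ := one_mul _
    have hgc := hg.continuous
    have hgc' := hg.continuous_fderiv one_ne_zero
    calc _ ≤ eLpNorm (fun x => (K * ‖g x‖ + ‖fderiv ℝ g x‖ : ℝ)) 2 volume := eLpNorm_mono hfd
      _ ≤ eLpNorm (fun x => (K * ‖g x‖ : ℝ)) 2 volume + eLpNorm (fun x => (‖fderiv ℝ g x‖ : ℝ)) 2 volume :=
        eLpNorm_add_le (by fun_prop) (by fun_prop) (by norm_num)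
      _ = ENNReal.ofReal K * eLpNorm g 2 volume + eLpNorm (fderiv ℝ g) 2 volume := by
        congr 1
        · have := eLpNorm_const_smul K (fun x => ‖g x‖) 2 (volume : Measure E3)
          rw [eLpNorm_norm] at this
          rw [← Real.enorm_of_nonneg hK0]
          exact this
        · exact eLpNorm_norm _
      _ ≤ _ := by
        rw [mul_add, add_mul, add_mul, one_mul, one_mul]
        gcongr
        · exact le_self_add
        · exact le_add_self
  have hlim := Lp.eLpNorm_lim_le_liminf_eLpNorm (p := 6) (μ := (volume : Measure E3))
    (f := fun n x => η n x • g x) (fun n => ((h1 n).smul hg).continuous.aestronglyMeasurable) g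
    (Filter.Eventually.of_forall fun x => by
      apply tendsto_const_nhds.congr'
      obtain ⟨N, hN⟩ := exists_nat_ge ‖x‖
      filter_upwards [Filter.eventually_ge_atTop N] with n hn
      rw [h5 n x (hN.trans (by exact_mod_cast hn)), one_smul])
  refine hlim.trans ?_
  apply Filter.liminf_le_of_le
  · isBoundedDefault
  · intro b hb
    obtain ⟨n, hn⟩ := hb.exists
    exact hn.trans (key n)

lemma aux_scale (g : E3 → A3) (hg : Continuous g) (x : E3) (t : ℝ) (ht : 0 < t) :
    eLpNorm (fun y => g (x + t • y)) 6 volume = ENNReal.ofReal (t ^ (-(1/2) : ℝ)) * eLpNorm g 6 volume := by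
  have h1 : eLpNorm (fun y => g (x + y)) 6 volume = eLpNorm g 6 volume :=
    eLpNorm_comp_measurePreserving (hg.aestronglyMeasurable) (measurePreserving_add_left volume x)
  have h2 := eLpNorm_map_measure (μ := (volume : Measure E3)) (p := 6) (f := fun y : E3 => t • y)
    (g := fun y => g (x + y)) (by fun_prop) (by fun_prop)
  rw [Measure.map_addHaar_smul _ ht.ne', eLpNorm_smul_measure_of_ne_top (by norm_num), h1] at h2
  have h3 : (fun y => g (x + t • y)) = (fun y => g (x + y)) ∘ (fun y : E3 => t • y) := rfl
  rw [h3, ← h2, smul_eq_mul]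
  congr 1
  rw [ENNReal.ofReal_rpow_of_nonneg (by positivity) (by simp)]
  congr 1
  rw [abs_of_nonneg (by positivity), finrank_euclideanSpace_fin, ← Real.rpow_natCast,
    ← Real.rpow_neg ht.le, ← Real.rpow_mul ht.le]
  norm_num

lemma aux_ftc (u : E3 → ℂ) (hu : ContDiff ℝ 1 u) (x y : E3) (hy : ‖y‖ ≤ 1) :
    ‖u x‖ₑ ≤ ‖u (x + y)‖ₑ + ∫⁻ t in Set.Ioc (0:ℝ) 1, ‖fderiv ℝ u (x + t • y)‖ₑ := by
  have hc := hu.continuous_fderiv one_ne_zero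
  have hd : ∀ t ∈ Set.uIcc (0:ℝ) 1, HasDerivAt (fun t : ℝ => u (x + t • y)) (fderiv ℝ u (x + t • y) y) t := by
    intro t _
    have h1 : HasDerivAt (fun t : ℝ => x + t • y) y t := by
      simpa using ((hasDerivAt_id t).smul_const y).const_add x
    exact ((hu.differentiable one_ne_zero (x + t • y)).hasFDerivAt).comp_hasDerivAt t h1
  have hcont : Continuous (fun t : ℝ => fderiv ℝ u (x + t • y) y) := by fun_prop
  have hi := intervalIntegral.integral_eq_sub_of_hasDerivAt hd (hcont.intervalIntegrable 0 1)
  simp only [one_smul, zero_smul, add_zero] at hi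
  rw [intervalIntegral.integral_of_le zero_le_one] at hi
  have : u x = u (x + y) - ∫ t in Set.Ioc (0:ℝ) 1, fderiv ℝ u (x + t • y) y := by rw [hi]; ring
  rw [this]
  refine (enorm_sub_le).trans ?_
  gcongr
  refine (enorm_integral_le_lintegral_enorm _).trans ?_
  gcongr with t
  have := ContinuousLinearMap.le_opNorm (fderiv ℝ u (x + t • y)) y
  rw [← ofReal_norm, ← ofReal_norm]
  apply ENNReal.ofReal_le_ofReal
  refine this.trans ?_
  calc _ ≤ ‖fderiv ℝ u (x + t • y)‖ * 1 := by gcongr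
    _ = _ := mul_one _

lemma aux_sup0 : ∃ C : ℝ≥0∞, C ≠ ⊤ ∧ ∀ u : E3 → ℂ, ContDiff ℝ 1 u → ∀ x,
    ‖u x‖ₑ ≤ C * (eLpNorm u 2 volume + eLpNorm (fderiv ℝ u) 6 volume) := by
  let B : Set E3 := Metric.closedBall 0 1
  let V : ℝ≥0∞ := volume B
  have hV0 : V ≠ 0 := (Metric.measure_closedBall_pos volume (0:E3) one_pos).ne'
  have hVt : V ≠ ⊤ := measure_closedBall_lt_top.ne
  let T : ℝ≥0∞ := ∫⁻ t in Set.Ioc (0:ℝ) 1, ENNReal.ofReal (t ^ (-(1/2) : ℝ))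
  have hT : T ≠ ⊤ := by
    have := (intervalIntegral.intervalIntegrable_rpow' (a := 0) (b := 1) (r := -(1/2)) (by norm_num)).1
    exact this.lintegral_lt_top.ne
  refine ⟨V⁻¹ * (V ^ (1/2 : ℝ) + T * V ^ (5/6 : ℝ)), ?_, fun u hu x => ?_⟩
  · have := ENNReal.inv_ne_top.2 hV0
    have := ENNReal.rpow_ne_top_of_nonneg (by norm_num : (0:ℝ) ≤ 1/2) hVt
    have := ENNReal.rpow_ne_top_of_nonneg (by norm_num : (0:ℝ) ≤ 5/6) hVt
    finiteness
  have hc := hu.continuous_fderiv one_ne_zero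
  have huc := hu.continuous
  have e1 : ∫⁻ y in B, ‖u (x + y)‖ₑ ≤ eLpNorm u 2 volume * V ^ (1/2 : ℝ) := by
    have h1 : eLpNorm (fun y => u (x + y)) 2 volume = eLpNorm u 2 volume :=
      eLpNorm_comp_measurePreserving (huc.aestronglyMeasurable) (measurePreserving_add_left volume x)
    have h2 := eLpNorm_le_eLpNorm_mul_rpow_measure_univ (μ := volume.restrict B)
      (f := fun y => u (x + y)) (p := 1) (q := 2) (by norm_num) (by fun_prop)
    rw [eLpNorm_one_eq_lintegral_enorm, Measure.restrict_apply_univ] at h2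
    refine h2.trans ?_
    have : (1 / (1:ℝ≥0∞).toReal - 1 / (2:ℝ≥0∞).toReal) = (1/2 : ℝ) := by norm_num
    rw [this, ← h1]
    gcongr
    exact Measure.restrict_le_self
  have e2 : ∀ t ∈ Set.Ioc (0:ℝ) 1, ∫⁻ y in B, ‖fderiv ℝ u (x + t • y)‖ₑ ≤
      ENNReal.ofReal (t ^ (-(1/2) : ℝ)) * (eLpNorm (fderiv ℝ u) 6 volume * V ^ (5/6 : ℝ)) := by
    intro t ht
    have h2 := eLpNorm_le_eLpNorm_mul_rpow_measure_univ (μ := volume.restrict B)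
      (f := fun y => fderiv ℝ u (x + t • y)) (p := 1) (q := 6) (by norm_num) (by fun_prop)
    rw [eLpNorm_one_eq_lintegral_enorm, Measure.restrict_apply_univ] at h2
    refine h2.trans ?_
    have : (1 / (1:ℝ≥0∞).toReal - 1 / (6:ℝ≥0∞).toReal) = (5/6 : ℝ) := by norm_num
    rw [this, ← mul_assoc, ← aux_scale (fderiv ℝ u) hc x t ht.1]
    gcongr
    exact Measure.restrict_le_self
  have e3 : V * ‖u x‖ₑ ≤ eLpNorm u 2 volume * V ^ (1/2 : ℝ) +
      T * (eLpNorm (fderiv ℝ u) 6 volume * V ^ (5/6 : ℝ)) := by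
    calc V * ‖u x‖ₑ = ∫⁻ y in B, ‖u x‖ₑ := by rw [setLIntegral_const, mul_comm]
      _ ≤ ∫⁻ y in B, (‖u (x + y)‖ₑ + ∫⁻ t in Set.Ioc (0:ℝ) 1, ‖fderiv ℝ u (x + t • y)‖ₑ) := by
        apply setLIntegral_mono' measurableSet_closedBall
        intro y hy
        exact aux_ftc u hu x y (by simpa [B] using hy)
      _ = (∫⁻ y in B, ‖u (x + y)‖ₑ) + ∫⁻ y in B, ∫⁻ t in Set.Ioc (0:ℝ) 1, ‖fderiv ℝ u (x + t • y)‖ₑ := by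
        apply lintegral_add_left
        exact Continuous.measurable (by fun_prop)
      _ = (∫⁻ y in B, ‖u (x + y)‖ₑ) + ∫⁻ t in Set.Ioc (0:ℝ) 1, ∫⁻ y in B, ‖fderiv ℝ u (x + t • y)‖ₑ := by
        congr 1
        apply lintegral_lintegral_swap
        apply Measurable.aemeasurable
        apply Continuous.measurable
        simp only [Function.uncurry_def]
        fun_prop
      _ ≤ eLpNorm u 2 volume * V ^ (1/2 : ℝ) + ∫⁻ t in Set.Ioc (0:ℝ) 1,
          ENNReal.ofReal (t ^ (-(1/2) : ℝ)) * (eLpNorm (fderiv ℝ u) 6 volume * V ^ (5/6 : ℝ)) := by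
        exact add_le_add e1 (setLIntegral_mono' measurableSet_Ioc e2)
      _ = _ := by
        congr 1
        rw [lintegral_mul_const _ (by fun_prop)]
  have e4 : ‖u x‖ₑ = V⁻¹ * (V * ‖u x‖ₑ) := by
    rw [← mul_assoc, ENNReal.inv_mul_cancel hV0 hVt, one_mul]
  rw [e4, mul_assoc]
  refine mul_le_mul_right (e3.trans ?_) _
  rw [add_mul, mul_add, mul_add, mul_comm (V ^ (1/2:ℝ)), mul_assoc T, mul_assoc T,
    mul_comm (V ^ (5/6:ℝ)) (eLpNorm (fderiv ℝ u) 6 volume)]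
  exact add_le_add le_self_add le_add_self

lemma aux_L4 (a : E3 → ℝ) (ha : Continuous a) (N : ℝ≥0∞) (h2 : eLpNorm a 2 volume ≤ N)
    (h6 : eLpNorm a 6 volume ≤ N) : eLpNorm a 4 volume ≤ N := by
  have e2 : ∫⁻ x, ‖a x‖ₑ ^ (2:ℝ) ≤ N ^ (2:ℝ) := by
    rw [eLpNorm_eq_lintegral_rpow_enorm_toReal (by norm_num) (by norm_num)] at h2
    have h := ENNReal.rpow_le_rpow h2 (by norm_num : (0:ℝ) ≤ 2)
    rw [← ENNReal.rpow_mul] at h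
    simpa using h
  have e6 : ∫⁻ x, ‖a x‖ₑ ^ (6:ℝ) ≤ N ^ (6:ℝ) := by
    rw [eLpNorm_eq_lintegral_rpow_enorm_toReal (by norm_num) (by norm_num)] at h6
    have h := ENNReal.rpow_le_rpow h6 (by norm_num : (0:ℝ) ≤ 6)
    rw [← ENNReal.rpow_mul] at h
    simpa using h
  have e4 : ∫⁻ x, ‖a x‖ₑ ^ (4:ℝ) ≤ N ^ (4:ℝ) := by
    have h := ENNReal.lintegral_mul_le_Lp_mul_Lq (volume : Measure E3) (p := 2) (q := 2)
      (by constructor <;> norm_num) (f := fun x => ‖a x‖ₑ ^ (1:ℝ)) (g := fun x => ‖a x‖ₑ ^ (3:ℝ))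
      (by fun_prop) (by fun_prop)
    simp only [Pi.mul_apply, ← ENNReal.rpow_mul,
      ← ENNReal.rpow_add_of_nonneg (1:ℝ) (3:ℝ) (by norm_num) (by norm_num)] at h
    norm_num at h
    calc _ ≤ _ := by simpa using h
      _ ≤ (N ^ (2:ℝ)) ^ (1/2:ℝ) * (N ^ (6:ℝ)) ^ (1/2:ℝ) := by
        refine mul_le_mul' ?_ ?_
        · simpa using ENNReal.rpow_le_rpow e2 (by norm_num : (0:ℝ) ≤ 1/2)
        · simpa using ENNReal.rpow_le_rpow e6 (by norm_num : (0:ℝ) ≤ 1/2)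
      _ = _ := by
        rw [← ENNReal.rpow_mul, ← ENNReal.rpow_mul, ← ENNReal.rpow_add_of_nonneg _ _ (by norm_num) (by norm_num)]
        norm_num
  rw [eLpNorm_eq_lintegral_rpow_enorm_toReal (by norm_num) (by norm_num)]
  have := ENNReal.rpow_le_rpow e4 (by norm_num : (0:ℝ) ≤ 1/4)
  rw [← ENNReal.rpow_mul] at this
  simpa using this

/-- Norm of the `i`-th derivative. -/
noncomputable def Dn (i : ℕ) (f : E3 → ℂ) (x : E3) : ℝ := ‖iteratedFDeriv ℝ i f x‖

lemma Dn_cont (i : ℕ) (hi : i ≤ 2) (f : E3 → ℂ) (hf : ContDiff ℝ 2 f) : Continuous (Dn i f) := by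
  unfold Dn
  exact (hf.continuous_iteratedFDeriv (by exact_mod_cast hi)).norm

lemma H2norm_eq (f : E3 → ℂ) : H2norm f =
    eLpNorm (Dn 0 f) 2 volume + eLpNorm (Dn 1 f) 2 volume + eLpNorm (Dn 2 f) 2 volume := by
  unfold H2norm
  congr 2
  rw [← eLpNorm_norm]
  congr 1
  ext x
  simp [Dn]

lemma Dn_le (i : ℕ) (hi : i ≤ 2) (f : E3 → ℂ) : eLpNorm (Dn i f) 2 volume ≤ H2norm f := by
  rw [H2norm_eq]
  interval_cases i
  · exact le_self_add.trans le_self_add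
  · exact le_add_self.trans le_self_add
  · exact le_add_self

lemma aux_embed : ∃ C : ℝ≥0∞, C ≠ ⊤ ∧ ∀ f : E3 → ℂ, ContDiff ℝ 2 f →
    eLpNorm (Dn 0 f) ⊤ volume ≤ C * H2norm f ∧ eLpNorm (Dn 1 f) 4 volume ≤ C * H2norm f := by
  obtain ⟨C6, hC6, h6⟩ := aux_L6 A3
  obtain ⟨Cs, hCs, hs⟩ := aux_sup0
  refine ⟨Cs * (1 + 2 * C6) + (1 + 2 * C6), by finiteness, fun f hf => ?_⟩
  have hf1 : ContDiff ℝ 1 f := hf.of_le (by norm_num)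
  have hg : ContDiff ℝ 1 (fderiv ℝ f) := hf.fderiv_right (by norm_num)
  have d1 : eLpNorm (Dn 1 f) 2 volume = eLpNorm (fderiv ℝ f) 2 volume := by
    rw [← eLpNorm_norm (fderiv ℝ f)]
    congr 1; ext x
    exact norm_iteratedFDeriv_one f
  have d16 : eLpNorm (Dn 1 f) 6 volume = eLpNorm (fderiv ℝ f) 6 volume := by
    rw [← eLpNorm_norm (fderiv ℝ f)]
    congr 1; ext x
    exact norm_iteratedFDeriv_one f
  have d2 : eLpNorm (Dn 2 f) 2 volume = eLpNorm (fderiv ℝ (fderiv ℝ f)) 2 volume := by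
    rw [← eLpNorm_norm (fderiv ℝ (fderiv ℝ f))]
    congr 1; ext x
    rw [← norm_iteratedFDeriv_one, norm_iteratedFDeriv_fderiv, Dn]
  have d0 : eLpNorm (Dn 0 f) 2 volume = eLpNorm f 2 volume := by
    rw [← eLpNorm_norm f]
    congr 1; ext x
    simp [Dn]
  have b0 := Dn_le 0 (by norm_num) f
  have b1 := Dn_le 1 (by norm_num) f
  have b2 := Dn_le 2 le_rfl f
  have k6 : eLpNorm (fderiv ℝ f) 6 volume ≤ 2 * C6 * H2norm f := by
    calc _ ≤ _ := h6 _ hg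
      _ ≤ C6 * (H2norm f + H2norm f) := by rw [← d1, ← d2]; gcongr
      _ = _ := by ring
  constructor
  · rw [eLpNorm_exponent_top]
    apply eLpNormEssSup_le_of_ae_enorm_bound
    filter_upwards with x
    have : ‖Dn 0 f x‖ₑ = ‖f x‖ₑ := by
      simp [Dn]
    rw [this]
    calc _ ≤ _ := hs f hf1 x
      _ ≤ Cs * (H2norm f + 2 * C6 * H2norm f) := by rw [← d0]; gcongr
      _ = Cs * (1 + 2 * C6) * H2norm f := by ring
      _ ≤ _ := by gcongr; exact le_self_add
  · calc _ ≤ (1 + 2 * C6) * H2norm f := by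
          apply aux_L4 _ (Dn_cont 1 (by norm_num) f hf)
          · rw [add_mul, one_mul]; exact le_trans b1 le_self_add
          · rw [add_mul, d16]; exact le_trans k6 le_add_self
      _ ≤ (Cs * (1 + 2 * C6) + (1 + 2 * C6)) * H2norm f := mul_le_mul_left le_add_self _

lemma aux_holder (a b : E3 → ℝ) (ha : Continuous a) (hb : Continuous b) (p q : ℝ≥0∞)
    [ENNReal.HolderTriple p q 2] :
    eLpNorm (fun x => a x * b x) 2 volume ≤ eLpNorm a p volume * eLpNorm b q volume :=
  eLpNorm_smul_le_mul_eLpNorm (f := b) (φ := a) hb.aestronglyMeasurable ha.aestronglyMeasurable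

lemma aux_prod : ∃ C : ℝ≥0∞, C ≠ ⊤ ∧ ∀ f g : E3 → ℂ, ContDiff ℝ 2 f → ContDiff ℝ 2 g →
    H2norm (fun x => f x * g x) ≤ C * H2norm f * H2norm g := by
  obtain ⟨C, hC, h⟩ := aux_embed
  refine ⟨C + 2 * C + (2 * C + 2 * (C * C)), by finiteness, fun f g hf hg => ?_⟩
  have P : ∀ i ≤ 2, eLpNorm (fun x => Dn 0 f x * Dn i g x) 2 volume ≤ C * H2norm f * H2norm g := by
    intro i hi
    refine (aux_holder _ _ (Dn_cont 0 (by norm_num) f hf) (Dn_cont i hi g hg) ⊤ 2).trans ?_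
    gcongr
    · exact (h f hf).1
    · exact Dn_le i hi g
  have Q : ∀ i ≤ 2, eLpNorm (fun x => Dn i f x * Dn 0 g x) 2 volume ≤ C * H2norm f * H2norm g := by
    intro i hi
    refine (aux_holder _ _ (Dn_cont i hi f hf) (Dn_cont 0 (by norm_num) g hg) 2 ⊤).trans ?_
    calc _ ≤ H2norm f * (C * H2norm g) := by
          gcongr
          · exact Dn_le i hi f
          · exact (h g hg).1
      _ = _ := by ring
  have R : eLpNorm (fun x => Dn 1 f x * Dn 1 g x) 2 volume ≤ C * C * H2norm f * H2norm g := by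
    have : ENNReal.HolderTriple 4 4 2 := ⟨by
      rw [← two_mul, show (4:ℝ≥0∞) = 2 * 2 by norm_num,
        ENNReal.mul_inv (by norm_num) (by norm_num), ← mul_assoc,
        ENNReal.mul_inv_cancel (by norm_num) (by norm_num), one_mul]⟩
    refine (aux_holder _ _ (Dn_cont 1 (by norm_num) f hf) (Dn_cont 1 (by norm_num) g hg) 4 4).trans ?_
    calc _ ≤ (C * H2norm f) * (C * H2norm g) := by
          gcongr
          · exact (h f hf).2
          · exact (h g hg).2
      _ = _ := by ring
  have cf := fun i hi => Dn_cont i hi f hf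
  have cg := fun i hi => Dn_cont i hi g hg
  have cf0 := cf 0 (by norm_num)
  have cf1 := cf 1 (by norm_num)
  have cf2 := cf 2 (by norm_num)
  have cg0 := cg 0 (by norm_num)
  have cg1 := cg 1 (by norm_num)
  have cg2 := cg 2 (by norm_num)
  have hpos : ∀ i (f : E3 → ℂ) x, 0 ≤ Dn i f x := fun i f x => norm_nonneg _
  have D : ∀ i ≤ 2, ∀ x, Dn i (fun x => f x * g x) x ≤
      ∑ j ∈ Finset.range (i+1), (i.choose j : ℝ) * Dn j f x * Dn (i - j) g x := by
    intro i hi x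
    exact norm_iteratedFDeriv_mul_le hf hg x (by exact_mod_cast hi)
  rw [H2norm_eq]
  set X := H2norm f
  set Y := H2norm g
  have T0 : eLpNorm (Dn 0 (fun x => f x * g x)) 2 volume ≤ C * X * Y := by
    refine (eLpNorm_mono_real (fun x => ?_)).trans (P 0 (by norm_num))
    rw [Real.norm_of_nonneg (hpos _ _ _)]
    simpa using D 0 (by norm_num) x
  have T1 : eLpNorm (Dn 1 (fun x => f x * g x)) 2 volume ≤ C * X * Y + C * X * Y := by
    refine le_trans ?_ (add_le_add (P 1 (by norm_num)) (Q 1 (by norm_num)))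
    refine le_trans ?_ (eLpNorm_add_le (by fun_prop) (by fun_prop) (by norm_num))
    refine (eLpNorm_mono_real (fun x => ?_))
    rw [Real.norm_of_nonneg (hpos _ _ _)]
    simpa [Finset.sum_range_succ] using D 1 (by norm_num) x
  have T2 : eLpNorm (Dn 2 (fun x => f x * g x)) 2 volume ≤
      (C * X * Y + C * X * Y) + (C * C * X * Y + C * C * X * Y) := by
    have s1 := eLpNorm_add_le (μ := (volume : Measure E3)) (p := 2)
      (f := fun x => Dn 0 f x * Dn 2 g x) (g := fun x => Dn 2 f x * Dn 0 g x)
      (cf0.mul cg2).aestronglyMeasurable (cf2.mul cg0).aestronglyMeasurable (by norm_num)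
    have s2 := eLpNorm_add_le (μ := (volume : Measure E3)) (p := 2)
      (f := fun x => Dn 1 f x * Dn 1 g x) (g := fun x => Dn 1 f x * Dn 1 g x)
      (cf1.mul cg1).aestronglyMeasurable (cf1.mul cg1).aestronglyMeasurable (by norm_num)
    have s3 := eLpNorm_add_le (μ := (volume : Measure E3)) (p := 2)
      (f := (fun x => Dn 0 f x * Dn 2 g x) + (fun x => Dn 2 f x * Dn 0 g x))
      (g := (fun x => Dn 1 f x * Dn 1 g x) + (fun x => Dn 1 f x * Dn 1 g x))
      ((cf0.mul cg2).add (cf2.mul cg0)).aestronglyMeasurable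
      ((cf1.mul cg1).add (cf1.mul cg1)).aestronglyMeasurable (by norm_num)
    refine le_trans (le_trans ?_ s3) (add_le_add
      (s1.trans (add_le_add (P 2 (by norm_num)) (Q 2 (by norm_num))))
      (s2.trans (add_le_add R R)))
    refine (eLpNorm_mono_real (fun x => ?_))
    rw [Real.norm_of_nonneg (hpos _ _ _)]
    have := D 2 (by norm_num) x
    simp [Finset.sum_range_succ] at this
    simp only [Pi.add_apply]
    linarith
  calc _ ≤ _ := add_le_add (add_le_add T0 T1) T2
    _ = _ := by ring

noncomputable def wt (s : ℝ) (x : E3) : ℝ := (1 + ‖x‖ ^ 2) ^ (-s / 2)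

lemma wt_contDiff (s : ℝ) : ContDiff ℝ 2 (wt s) := by
  unfold wt
  apply ContDiff.rpow_const_of_ne
  · exact contDiff_const.add (contDiff_norm_sq ℝ)
  · intro x; positivity

lemma wt_nonneg (s : ℝ) (x : E3) : 0 ≤ wt s x := by unfold wt; positivity

lemma wt_le_one (s : ℝ) (hs : 0 ≤ s) (x : E3) : wt s x ≤ 1 := by
  unfold wt
  apply Real.rpow_le_one_of_one_le_of_nonpos
  · nlinarith [sq_nonneg ‖x‖]
  · linarith

lemma wt_sq (s : ℝ) (hs : 0 ≤ s) (x : E3) : wt (s + 2) x * (1 + ‖x‖ ^ 2) ≤ 1 := by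
  have : wt (s + 2) x * (1 + ‖x‖ ^ 2) = wt s x := by
    unfold wt
    nth_rewrite 2 [← Real.rpow_one (1 + ‖x‖ ^ 2)]
    rw [← Real.rpow_add (by positivity)]
    congr 1; ring
  rw [this]
  exact wt_le_one s hs x

lemma wt_fderiv (s : ℝ) : fderiv ℝ (wt s) = fun x => (-s) • wt (s + 2) x • innerSL ℝ x := by
  ext1 x
  have h1 : HasFDerivAt (fun x : E3 => 1 + ‖x‖ ^ 2) (2 • innerSL ℝ x) x :=
    ((hasStrictFDerivAt_norm_sq x).hasFDerivAt).const_add 1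
  have h2 := h1.rpow_const (p := -s/2) (Or.inl (by positivity))
  have h3 : HasFDerivAt (wt s) _ x := h2
  rw [h3.fderiv]
  ext y
  simp only [wt, smul_apply, smul_eq_mul, nsmul_eq_mul]
  rw [show -(s+2)/2 = -s/2 - 1 by ring]
  push_cast
  ring

lemma wt_D1 (s : ℝ) (hs : 0 ≤ s) (x : E3) : ‖fderiv ℝ (wt s) x‖ ≤ s := by
  rw [wt_fderiv, norm_smul, norm_smul, innerSL_apply_norm, norm_neg, Real.norm_of_nonneg hs,
    Real.norm_of_nonneg (wt_nonneg _ _)]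
  have h1 := wt_sq s hs x
  have h2 := wt_nonneg (s + 2) x
  have h3 : wt (s+2) x * ‖x‖ ≤ 1 := by nlinarith [sq_nonneg (‖x‖ - 1), sq_nonneg ‖x‖]
  nlinarith

lemma aux_smul_bound {V : Type*} [NormedAddCommGroup V] [NormedSpace ℝ V] (c : ℝ) (m : E3 → ℝ)
    (L : E3 →L[ℝ] V) (x : E3) (hm : DifferentiableAt ℝ m x) :
    ‖fderiv ℝ (fun x => c • m x • L x) x‖ ≤ |c| * (|m x| * ‖L‖ + ‖fderiv ℝ m x‖ * ‖L x‖) := by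
  have h : HasFDerivAt (fun x => c • m x • L x) _ x :=
    (hm.hasFDerivAt.smul L.hasFDerivAt).const_smul c
  rw [h.fderiv, norm_smul, Real.norm_eq_abs]
  gcongr
  refine (norm_add_le _ _).trans ?_
  rw [norm_smul, Real.norm_eq_abs, ContinuousLinearMap.norm_smulRight_apply]

lemma wt_D2 (s : ℝ) (hs : 0 ≤ s) (x : E3) :
    ‖fderiv ℝ (fderiv ℝ (wt s)) x‖ ≤ s * (s + 3) := by
  rw [wt_fderiv]
  have hd : DifferentiableAt ℝ (wt (s+2)) x := (wt_contDiff (s+2)).differentiable (by norm_num) x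
  refine (aux_smul_bound (-s) (wt (s+2)) (innerSL ℝ) x hd).trans ?_
  rw [abs_neg, abs_of_nonneg hs, abs_of_nonneg (wt_nonneg _ _)]
  refine mul_le_mul_of_nonneg_left ?_ hs
  have e1 : wt (s+2) x * ‖(innerSL ℝ : E3 →L[ℝ] E3 →L[ℝ] ℝ)‖ ≤ 1 * 1 := by
    gcongr
    · exact wt_le_one _ (by linarith) x
    · exact norm_innerSL_le ℝ
  have e2 : ‖fderiv ℝ (wt (s+2)) x‖ * ‖innerSL ℝ x‖ ≤ s + 2 := by
    rw [wt_fderiv, norm_smul, norm_smul, innerSL_apply_norm, norm_neg,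
      Real.norm_of_nonneg (by linarith : 0 ≤ s + 2), Real.norm_of_nonneg (wt_nonneg _ _)]
    have h1 := wt_sq (s+2) (by linarith) x
    have h2 := wt_nonneg (s + 2 + 2) x
    have h3 : wt (s+2+2) x * ‖x‖ * ‖x‖ ≤ 1 := by nlinarith
    nlinarith
  linarith

lemma aux_wt (s : ℝ) (hs : 0 ≤ s) : ∃ K : ℝ, 0 ≤ K ∧ ∀ i ≤ 2, ∀ x, ‖iteratedFDeriv ℝ i (wt s) x‖ ≤ K := by
  refine ⟨1 + s + s * (s + 3), by positivity, fun i hi x => ?_⟩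
  have p : 0 ≤ s * (s + 3) := by positivity
  interval_cases i
  · rw [norm_iteratedFDeriv_zero, Real.norm_of_nonneg (wt_nonneg _ _)]
    linarith [wt_le_one s hs x]
  · rw [norm_iteratedFDeriv_one]
    linarith [wt_D1 s hs x]
  · rw [← norm_iteratedFDeriv_fderiv, norm_iteratedFDeriv_one]
    linarith [wt_D2 s hs x]

lemma aux_mult (s : ℝ) (hs : 0 ≤ s) : ∃ C : ℝ≥0∞, C ≠ ⊤ ∧ ∀ f : E3 → ℂ, ContDiff ℝ 2 f →
    H2norm (fun x => wt s x • f x) ≤ C * H2norm f := by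
  obtain ⟨K, hK0, hK⟩ := aux_wt s hs
  refine ⟨3 * (ENNReal.ofReal (2 * K) * 3), by finiteness, fun f hf => ?_⟩
  have c0 := Dn_cont 0 (by norm_num) f hf
  have c1 := Dn_cont 1 (by norm_num) f hf
  have c2 := Dn_cont 2 (by norm_num) f hf
  have hpos : ∀ i (f : E3 → ℂ) x, 0 ≤ Dn i f x := fun i f x => norm_nonneg _
  have S : eLpNorm (fun x => Dn 0 f x + Dn 1 f x + Dn 2 f x) 2 volume ≤ 3 * H2norm f := by
    refine (eLpNorm_add_le (f := fun x => Dn 0 f x + Dn 1 f x) (by fun_prop) (by fun_prop) (by norm_num)).trans ?_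
    calc _ ≤ (H2norm f + H2norm f) + H2norm f := by
          refine add_le_add ((eLpNorm_add_le (by fun_prop) (by fun_prop) (by norm_num)).trans
            (add_le_add ?_ ?_)) ?_ <;> exact Dn_le _ (by norm_num) f
      _ = _ := by ring
  have T : ∀ i ≤ 2, eLpNorm (Dn i (fun x => wt s x • f x)) 2 volume ≤
      ENNReal.ofReal (2 * K) * 3 * H2norm f := by
    intro i hi
    have h1 : ∀ x, ‖Dn i (fun x => wt s x • f x) x‖ ≤ (2 * K) • (Dn 0 f x + Dn 1 f x + Dn 2 f x) := by
      intro x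
      rw [Real.norm_of_nonneg (hpos _ _ _)]
      refine (norm_iteratedFDeriv_smul_le (wt_contDiff s) hf x (by exact_mod_cast hi)).trans ?_
      have k0 := fun {a : ℝ} (ha : 0 ≤ a) => mul_le_mul_of_nonneg_right (hK 0 (by norm_num) x) ha
      have k1 := fun {a : ℝ} (ha : 0 ≤ a) => mul_le_mul_of_nonneg_right (hK 1 (by norm_num) x) ha
      have k2 := fun {a : ℝ} (ha : 0 ≤ a) => mul_le_mul_of_nonneg_right (hK 2 (by norm_num) x) ha
      have m0 := mul_nonneg hK0 (hpos 0 f x)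
      have m1 := mul_nonneg hK0 (hpos 1 f x)
      have m2 := mul_nonneg hK0 (hpos 2 f x)
      simp only [← Dn.eq_1, smul_eq_mul]
      interval_cases i
      · simp only [Finset.sum_range_succ, Finset.sum_range_zero]
        norm_num only [Nat.choose]
        nlinarith [k0 (hpos 0 f x)]
      · simp only [Finset.sum_range_succ, Finset.sum_range_zero]
        norm_num [Nat.choose, -norm_iteratedFDeriv_zero, -norm_iteratedFDeriv_one]
        nlinarith [k0 (hpos 1 f x), k1 (hpos 0 f x)]
      · simp only [Finset.sum_range_succ, Finset.sum_range_zero]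
        norm_num [Nat.choose, -norm_iteratedFDeriv_zero, -norm_iteratedFDeriv_one]
        nlinarith [k0 (hpos 2 f x), k1 (hpos 1 f x), k2 (hpos 0 f x)]
    refine (eLpNorm_mono_real h1).trans ?_
    refine (eLpNorm_const_smul (2 * K) (fun x => Dn 0 f x + Dn 1 f x + Dn 2 f x) 2 volume).le.trans ?_
    rw [Real.enorm_of_nonneg (by positivity), mul_assoc]
    gcongr
  rw [H2norm_eq]
  calc _ ≤ _ := add_le_add (add_le_add (T 0 (by norm_num)) (T 1 (by norm_num))) (T 2 le_rfl)
    _ = _ := by ring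

/-- Weighted product estimate: for `l ≥ 0`,
`‖φχ‖_{H^{2,l}} ≲ ‖φ‖_{H^{2,l}} ‖χ‖_{H^{2,l}}`. -/
theorem stmt7 (l : ℝ) (hl : 0 ≤ l) :
    ∃ C : ℝ≥0∞, C ≠ ⊤ ∧ ∀ φ χ : E3 → ℂ, ContDiff ℝ 2 φ → ContDiff ℝ 2 χ →
      H2wnorm l (fun x => φ x * χ x) ≤ C * H2wnorm l φ * H2wnorm l χ := by
  obtain ⟨C1, hC1, h1⟩ := aux_mult l hl
  obtain ⟨C2, hC2, h2⟩ := aux_prod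
  refine ⟨C1 * C2, by finiteness, fun φ χ hφ hχ => ?_⟩
  have hw : ∀ f : E3 → ℂ, ContDiff ℝ 2 f →
      ContDiff ℝ 2 (fun x => (((1 + ‖x‖ ^ 2) ^ (l / 2) : ℝ) : ℂ) * f x) := by
    intro f hf
    have h := (wt_contDiff (-l)).smul hf
    have e : (fun x => (((1 + ‖x‖ ^ 2) ^ (l / 2) : ℝ) : ℂ) * f x) = fun x => wt (-l) x • f x := by
      ext x
      simp [wt]
    rw [e]
    exact h
  have e : (fun x => (((1 + ‖x‖ ^ 2) ^ (l / 2) : ℝ) : ℂ) * (φ x * χ x)) =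
      fun x => wt l x • (((((1 + ‖x‖ ^ 2) ^ (l / 2) : ℝ) : ℂ) * φ x) *
        ((((1 + ‖x‖ ^ 2) ^ (l / 2) : ℝ) : ℂ) * χ x)) := by
    ext x
    have h : wt l x * (1 + ‖x‖ ^ 2) ^ (l / 2) = 1 := by
      unfold wt
      rw [← Real.rpow_add (by positivity), show -l / 2 + l / 2 = 0 by ring, Real.rpow_zero]
    rw [Complex.real_smul]
    have h' : ((wt l x : ℝ) : ℂ) * (((1 + ‖x‖ ^ 2) ^ (l / 2) : ℝ) : ℂ) = 1 := by
      exact_mod_cast h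
    linear_combination (-(((1 + ‖x‖ ^ 2) ^ (l / 2) : ℝ) : ℂ) * φ x * χ x) * h'
  unfold H2wnorm
  rw [e]
  refine (h1 _ ((hw φ hφ).mul (hw χ hχ))).trans ?_
  rw [mul_assoc, mul_assoc]
  gcongr
  rw [← mul_assoc]
  exact h2 _ _ (hw φ hφ) (hw χ hχ)
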